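/- Let n ≥ 2, N ≥ n+1, let β₁, …, β_N ∈ (0,∞), and let v₁, …, v_N ∈ S^{n−1} be unit vectors not contained in any closed hemisphere. Suppose P_i ∈ P(v₁, …, v_N) for each i, P ∈ P(v₁, …, v_N), and P_i → P in the Hausdorff metric as i → ∞. Then γ(P_i) → γ(P) and Φ_{P_i}(γ(P_i)) → Φ_P(γ(P)) as i → ∞. -/

import Mathlib

open scoped RealInnerProductSpace
open Filter

/-- The support function of a set `K ⊆ ℝⁿ`. -/
noncomputable def supportFn {n : ℕ} (K : Set (EuclideanSpace ℝ (Fin n)))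
    (x : EuclideanSpace ℝ (Fin n)) : ℝ :=
  sSup ((fun y => ⟪x, y⟫) '' K)

/-- Extended-real logarithm with the convention `log x = -∞` for `x ≤ 0`. -/
noncomputable def elog (x : ℝ) : EReal :=
  if x ≤ 0 then ⊥ else ((Real.log x : ℝ) : EReal)

/-- The functional `Φ_P(γ) = Σ β_k log(h(P, v_k) − γ·v_k)`, valued in the extended reals. -/
noncomputable def Phi {n N : ℕ} (β : Fin N → ℝ) (v : Fin N → EuclideanSpace ℝ (Fin n))
    (P : Set (EuclideanSpace ℝ (Fin n))) (γ : EuclideanSpace ℝ (Fin n)) : EReal :=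
  ∑ k, (β k : EReal) * elog (supportFn P (v k) - ⟪γ, v k⟫)

/-- A point of `K` is within `hausdorffDist K L` of some point of `L`. -/
theorem exists_dist_le_hausdorffDist {α : Type*} [MetricSpace α] {K L : Set α}
    (hK : IsCompact K) (hL : IsCompact L) (hLne : L.Nonempty) {y : α} (hy : y ∈ K) :
    ∃ z ∈ L, dist y z ≤ Metric.hausdorffDist K L := by
  obtain ⟨z, hz, hyz⟩ := hL.exists_infDist_eq_dist hLne y
  refine ⟨z, hz, hyz ▸ Metric.infDist_le_hausdorffDist_of_mem hy ?_⟩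
  exact Metric.hausdorffEDist_ne_top_of_nonempty_of_bounded ⟨y, hy⟩ hLne
    hK.isBounded hL.isBounded

section SupportFunction

variable {n : ℕ} {K L : Set (EuclideanSpace ℝ (Fin n))}

theorem inner_le_supportFn (hK : IsCompact K) (u : EuclideanSpace ℝ (Fin n))
    {y : EuclideanSpace ℝ (Fin n)} (hy : y ∈ K) : ⟪u, y⟫ ≤ supportFn K u :=
  le_csSup (hK.image (by fun_prop : Continuous fun y => ⟪u, y⟫)).bddAbove
    (Set.mem_image_of_mem _ hy)

theorem supportFn_le_add_hausdorffDist (hK : IsCompact K) (hL : IsCompact L)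
    (hKne : K.Nonempty) (hLne : L.Nonempty) {u : EuclideanSpace ℝ (Fin n)} (hu : ‖u‖ = 1) :
    supportFn K u ≤ supportFn L u + Metric.hausdorffDist K L := by
  refine csSup_le (hKne.image _) ?_
  rintro _ ⟨y, hy, rfl⟩
  obtain ⟨z, hz, hyz⟩ := exists_dist_le_hausdorffDist hK hL hLne hy
  have h1 := inner_le_supportFn hL u hz
  have h2 := real_inner_le_norm u (y - z)
  rw [hu, one_mul, inner_sub_right, ← dist_eq_norm] at h2
  dsimp only
  linarith

theorem abs_supportFn_sub_le_hausdorffDist (hK : IsCompact K) (hL : IsCompact L)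
    (hKne : K.Nonempty) (hLne : L.Nonempty) {u : EuclideanSpace ℝ (Fin n)} (hu : ‖u‖ = 1) :
    |supportFn K u - supportFn L u| ≤ Metric.hausdorffDist K L := by
  have h1 := supportFn_le_add_hausdorffDist hK hL hKne hLne hu
  have h2 := supportFn_le_add_hausdorffDist hL hK hLne hKne hu
  rw [Metric.hausdorffDist_comm] at h2
  rw [abs_le]
  constructor <;> linarith

theorem supportFn_sub_inner_pos_of_mem_interior (hK : IsCompact K)
    {u x : EuclideanSpace ℝ (Fin n)} (hu : ‖u‖ = 1) (hx : x ∈ interior K) :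
    0 < supportFn K u - ⟪x, u⟫ := by
  obtain ⟨ε, hε, hball⟩ := Metric.isOpen_iff.1 isOpen_interior x hx
  have hmem : x + (ε / 2) • u ∈ K := by
    refine interior_subset (hball ?_)
    rw [Metric.mem_ball, dist_eq_norm, add_sub_cancel_left, norm_smul, hu, mul_one,
      Real.norm_of_nonneg (by positivity)]
    linarith
  have h := inner_le_supportFn hK u hmem
  rw [inner_add_right, real_inner_smul_right, real_inner_self_eq_norm_sq, hu,
    real_inner_comm] at h
  linarith

end SupportFunction

section Functional

variable {n N : ℕ} {β : Fin N → ℝ} {v : Fin N → EuclideanSpace ℝ (Fin n)}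

/-- `∏ (h_k - x·v_k) ^ β_k`, the exponential of the functional `Phi`. -/
noncomputable def expPhi (β : Fin N → ℝ) (v : Fin N → EuclideanSpace ℝ (Fin n))
    (h : Fin N → ℝ) (x : EuclideanSpace ℝ (Fin n)) : ℝ :=
  ∏ k, (h k - ⟪x, v k⟫) ^ β k

theorem continuous_expPhi (hβ : ∀ k, 0 ≤ β k) :
    Continuous fun p : (Fin N → ℝ) × EuclideanSpace ℝ (Fin n) => expPhi β v p.1 p.2 := by
  refine continuous_finsetProd _ fun k _ => Continuous.rpow_const ?_ fun _ => Or.inr (hβ k)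
  fun_prop

theorem expPhi_pos {h : Fin N → ℝ} {x : EuclideanSpace ℝ (Fin n)}
    (hx : ∀ k, 0 < h k - ⟪x, v k⟫) : 0 < expPhi β v h x :=
  Finset.prod_pos fun k _ => Real.rpow_pos_of_pos (hx k) _

theorem Phi_eq_coe {P : Set (EuclideanSpace ℝ (Fin n))} {x : EuclideanSpace ℝ (Fin n)}
    (hx : ∀ k, 0 < supportFn P (v k) - ⟪x, v k⟫) :
    Phi β v P x = ((∑ k, β k * Real.log (supportFn P (v k) - ⟪x, v k⟫) : ℝ) : EReal) := by
  have hsum : ∀ (s : Finset (Fin N)) (f : Fin N → ℝ),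
      ((∑ k ∈ s, f k : ℝ) : EReal) = ∑ k ∈ s, (f k : EReal) :=
    fun s f => map_sum (⟨⟨Real.toEReal, EReal.coe_zero⟩, EReal.coe_add⟩ : ℝ →+ EReal) f s
  rw [Phi, hsum]
  refine Finset.sum_congr rfl fun k _ => ?_
  rw [elog, if_neg (not_le.2 (hx k)), EReal.coe_mul]

theorem expPhi_eq_exp {h : Fin N → ℝ} {x : EuclideanSpace ℝ (Fin n)}
    (hx : ∀ k, 0 < h k - ⟪x, v k⟫) :
    expPhi β v h x = Real.exp (∑ k, β k * Real.log (h k - ⟪x, v k⟫)) := by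
  rw [Real.exp_sum]
  refine Finset.prod_congr rfl fun k _ => ?_
  rw [Real.rpow_def_of_pos (hx k), mul_comm]

theorem expPhi_le_of_Phi_le {P : Set (EuclideanSpace ℝ (Fin n))}
    {x y : EuclideanSpace ℝ (Fin n)}
    (hx : ∀ k, 0 < supportFn P (v k) - ⟪x, v k⟫)
    (hy : ∀ k, 0 < supportFn P (v k) - ⟪y, v k⟫) (hxy : Phi β v P x ≤ Phi β v P y) :
    expPhi β v (fun k => supportFn P (v k)) x ≤ expPhi β v (fun k => supportFn P (v k)) y := by
  rw [Phi_eq_coe hx, Phi_eq_coe hy, EReal.coe_le_coe_iff] at hxy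
  rw [expPhi_eq_exp hx, expPhi_eq_exp hy]
  exact Real.exp_le_exp.2 hxy

/-- If the vectors `v k` lie in no closed hemisphere, a vector is determined by its inner products
with them. -/
theorem eq_of_forall_inner_eq
    (hhemi : ∀ u : EuclideanSpace ℝ (Fin n), ‖u‖ = 1 → ∃ k, 0 < ⟪v k, u⟫)
    {x y : EuclideanSpace ℝ (Fin n)} (hxy : ∀ k, ⟪x, v k⟫ = ⟪y, v k⟫) : x = y := by
  by_contra hne
  have hnorm : ‖x - y‖ ≠ 0 := norm_ne_zero_iff.2 (sub_ne_zero.2 hne)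
  obtain ⟨k, hk⟩ := hhemi (‖x - y‖⁻¹ • (x - y))
    (by rw [norm_smul, norm_inv, norm_norm, inv_mul_cancel₀ hnorm])
  rw [real_inner_smul_right, real_inner_comm, inner_sub_left, hxy k, sub_self, mul_zero] at hk
  exact hk.false

theorem sub_inner_midpoint (a : ℝ) (u x y : EuclideanSpace ℝ (Fin n)) :
    a - ⟪midpoint ℝ x y, u⟫ = ((a - ⟪x, u⟫) + (a - ⟪y, u⟫)) / 2 := by
  rw [midpoint_eq_smul_add, real_inner_smul_left, inner_add_left, invOf_eq_inv]
  ring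

/-- The functional `expPhi` is strictly log-concave (at midpoints). -/
theorem expPhi_mul_lt_sq_midpoint (hβ : ∀ k, 0 < β k)
    (hhemi : ∀ u : EuclideanSpace ℝ (Fin n), ‖u‖ = 1 → ∃ k, 0 < ⟪v k, u⟫)
    {h : Fin N → ℝ} {x y : EuclideanSpace ℝ (Fin n)} (hx : ∀ k, 0 < h k - ⟪x, v k⟫)
    (hy : ∀ k, 0 < h k - ⟪y, v k⟫) (hne : x ≠ y) :
    expPhi β v h x * expPhi β v h y < expPhi β v h (midpoint ℝ x y) ^ 2 := by
  obtain ⟨j, hj⟩ : ∃ k, ⟪x, v k⟫ ≠ ⟪y, v k⟫ := by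
    by_contra! hall
    exact hne (eq_of_forall_inner_eq hhemi hall)
  simp only [expPhi]
  rw [← Finset.prod_mul_distrib, ← Finset.prod_pow]
  have hsq : ∀ k, ((h k - ⟪midpoint ℝ x y, v k⟫) ^ β k) ^ 2 =
      (((h k - ⟪x, v k⟫) + (h k - ⟪y, v k⟫)) / 2 * (((h k - ⟪x, v k⟫) + (h k - ⟪y, v k⟫)) / 2))
        ^ β k := fun k => by
    have := hx k
    have := hy k
    rw [sub_inner_midpoint, Real.mul_rpow (by positivity) (by positivity), sq]
  refine Finset.prod_lt_prod (fun k _ => ?_) (fun k _ => ?_) ⟨j, Finset.mem_univ j, ?_⟩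
  · exact mul_pos (Real.rpow_pos_of_pos (hx k) _) (Real.rpow_pos_of_pos (hy k) _)
  · rw [hsq, ← Real.mul_rpow (hx k).le (hy k).le]
    refine Real.rpow_le_rpow (mul_pos (hx k) (hy k)).le ?_ (hβ k).le
    nlinarith [sq_nonneg ((h k - ⟪x, v k⟫) - (h k - ⟪y, v k⟫))]
  · rw [hsq, ← Real.mul_rpow (hx j).le (hy j).le]
    refine Real.rpow_lt_rpow (mul_pos (hx j) (hy j)).le ?_ (hβ j)
    have : 0 < (⟪x, v j⟫ - ⟪y, v j⟫) ^ 2 := by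
      have := sub_ne_zero.2 hj
      positivity
    nlinarith

end Functional

theorem maximizer_continuous_in_hausdorff_limit
    {n N : ℕ} (hn : 2 ≤ n) (hN : n + 1 ≤ N)
    (β : Fin N → ℝ) (hβ : ∀ k, 0 < β k)
    (v : Fin N → EuclideanSpace ℝ (Fin n)) (hv : ∀ k, ‖v k‖ = 1)
    (hhemi : ∀ u : EuclideanSpace ℝ (Fin n), ‖u‖ = 1 → ∃ k, 0 < ⟪v k, u⟫)
    (P : ℕ → Set (EuclideanSpace ℝ (Fin n))) (Q : Set (EuclideanSpace ℝ (Fin n)))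
    (hPcpt : ∀ i, IsCompact (P i)) (hPconv : ∀ i, Convex ℝ (P i))
    (hPint : ∀ i, (interior (P i)).Nonempty)
    (hPfacets : ∀ i, P i = ⋂ k, {x | ⟪x, v k⟫ ≤ supportFn (P i) (v k)})
    (hQcpt : IsCompact Q) (hQconv : Convex ℝ Q) (hQint : (interior Q).Nonempty)
    (hQfacets : Q = ⋂ k, {x | ⟪x, v k⟫ ≤ supportFn Q (v k)})
    (hconv : Tendsto (fun i => Metric.hausdorffDist (P i) Q) atTop (nhds 0))
    (γ : ℕ → EuclideanSpace ℝ (Fin n)) (γ₀ : EuclideanSpace ℝ (Fin n))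
    (hγ : ∀ i, γ i ∈ interior (P i) ∧ ∀ y ∈ P i, Phi β v (P i) y ≤ Phi β v (P i) (γ i))
    (hγ₀ : γ₀ ∈ interior Q ∧ ∀ y ∈ Q, Phi β v Q y ≤ Phi β v Q γ₀) :
    Tendsto γ atTop (nhds γ₀) ∧
      Tendsto (fun i => Phi β v (P i) (γ i)) atTop (nhds (Phi β v Q γ₀)) := by
  have hPne i : (P i).Nonempty := (hPint i).mono interior_subset
  have hQne : Q.Nonempty := hQint.mono interior_subset
  have hmemQ : ∀ x, (∀ k, 0 ≤ supportFn Q (v k) - ⟪x, v k⟫) → x ∈ Q := fun x hx => by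
    rw [hQfacets]
    exact Set.mem_iInter.2 fun k => sub_nonneg.1 (hx k)
  have hγpos i k : 0 < supportFn (P i) (v k) - ⟪γ i, v k⟫ :=
    supportFn_sub_inner_pos_of_mem_interior (hPcpt i) (hv k) (hγ i).1
  have hγ₀pos k : 0 < supportFn Q (v k) - ⟪γ₀, v k⟫ :=
    supportFn_sub_inner_pos_of_mem_interior hQcpt (hv k) hγ₀.1
  have hsupp k : Tendsto (fun i => supportFn (P i) (v k)) atTop (nhds (supportFn Q (v k))) := by
    rw [tendsto_iff_dist_tendsto_zero]
    exact squeeze_zero (fun _ => dist_nonneg) (fun i =>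
      abs_supportFn_sub_le_hausdorffDist (hPcpt i) hQcpt (hPne i) hQne (hv k)) hconv
  have hsupp' : Tendsto (fun i k => supportFn (P i) (v k)) atTop
      (nhds fun k => supportFn Q (v k)) := tendsto_pi_nhds.2 hsupp
  have hγ₀ev : ∀ᶠ i in atTop, ∀ k, 0 < supportFn (P i) (v k) - ⟪γ₀, v k⟫ :=
    eventually_all.2 fun k => ((hsupp k).sub_const _).eventually_const_lt (hγ₀pos k)
  have hle : ∀ᶠ i in atTop, expPhi β v (fun k => supportFn (P i) (v k)) γ₀ ≤
      expPhi β v (fun k => supportFn (P i) (v k)) (γ i) := by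
    filter_upwards [hγ₀ev] with i hi
    refine expPhi_le_of_Phi_le hi (hγpos i) ((hγ i).2 _ ?_)
    rw [hPfacets i]
    exact Set.mem_iInter.2 fun k => sub_nonneg.1 (hi k).le
  have hγmem : ∀ᶠ i in atTop, γ i ∈ Metric.cthickening 1 Q := by
    filter_upwards [hconv.eventually_le_const one_pos] with i hi
    obtain ⟨z, hz, hdist⟩ :=
      exists_dist_le_hausdorffDist (hPcpt i) hQcpt hQne (interior_subset (hγ i).1)
    exact Metric.mem_cthickening_of_dist_le _ z _ _ hz (hdist.trans hi)
  have hcont := continuous_expPhi (v := v) fun k => (hβ k).le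
  have hγlim : Tendsto γ atTop (nhds γ₀) := by
    refine hQcpt.cthickening.tendsto_nhds_of_unique_mapClusterPt hγmem fun x _ hx => ?_
    obtain ⟨ψ, hψ, hlim⟩ := hx.tendsto_subseq
    have hψt := hψ.tendsto_atTop
    have hxnonneg k : 0 ≤ supportFn Q (v k) - ⟪x, v k⟫ :=
      ge_of_tendsto' (((hsupp k).comp hψt).sub (hlim.inner tendsto_const_nhds))
        fun i => (hγpos (ψ i) k).le
    have hxle : expPhi β v (fun k => supportFn Q (v k)) γ₀ ≤
        expPhi β v (fun k => supportFn Q (v k)) x :=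
      le_of_tendsto_of_tendsto
        ((hcont.tendsto _).comp ((hsupp'.comp hψt).prodMk_nhds tendsto_const_nhds))
        ((hcont.tendsto _).comp ((hsupp'.comp hψt).prodMk_nhds hlim)) (hψt.eventually hle)
    have hpos₀ := expPhi_pos (β := β) hγ₀pos
    have hxpos k : 0 < supportFn Q (v k) - ⟪x, v k⟫ := by
      refine (hxnonneg k).lt_of_ne fun h0 => (hpos₀.trans_le hxle).ne' ?_
      exact Finset.prod_eq_zero (Finset.mem_univ k) (by rw [← h0, Real.zero_rpow (hβ k).ne'])
    by_contra hne
    have hmid := expPhi_mul_lt_sq_midpoint hβ hhemi hxpos hγ₀pos hne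
    have hmpos k : 0 < supportFn Q (v k) - ⟪midpoint ℝ x γ₀, v k⟫ := by
      rw [sub_inner_midpoint]
      have := hxpos k
      have := hγ₀pos k
      positivity
    have hmle := expPhi_le_of_Phi_le hmpos hγ₀pos (hγ₀.2 _ (hmemQ _ fun k => (hmpos k).le))
    have := expPhi_pos (β := β) hmpos
    nlinarith
  refine ⟨hγlim, ?_⟩
  rw [Phi_eq_coe hγ₀pos, tendsto_congr fun i => Phi_eq_coe (hγpos i), EReal.tendsto_coe]
  exact tendsto_finsetSum _ fun k _ => (((hsupp k).sub
    (hγlim.inner tendsto_const_nhds)).log (hγ₀pos k).ne').const_mul _
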